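/- There exists an absolute constant c > 0 such that every finite simple graph with minimum degree at least d contains a star factor in which every star has at least c·(d/log d)^{1/3} edges, for all sufficiently large d. -/

import Mathlib

section sf
open Finset

lemma sf_whall {V : Type} [Fintype V] [DecidableEq V] (C : Finset V) (w : V → V → ℝ)
    (hw : ∀ c v, 0 ≤ w c v) (K : ℕ) (h1 : ∀ v, ∑ c ∈ C, w c v ≤ 1)
    (h2 : ∀ c ∈ C, (K : ℝ) ≤ ∑ v, w c v) :
    ∃ P : V → Finset V, (∀ c ∈ C, (P c).card = K ∧ ∀ v ∈ P c, w c v ≠ 0) ∧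
      (∀ c ∈ C, ∀ c' ∈ C, ∀ v, v ∈ P c → v ∈ P c' → c = c') := by
  classical
  let t : (↥C × Fin K) → Finset V := fun p => univ.filter (fun v => w p.1 v ≠ 0)
  have hall : ∀ A : Finset (↥C × Fin K), A.card ≤ (A.biUnion t).card := by
    intro A
    let I : Finset ↥C := A.image (fun p => p.1)
    have e1 : A.card ≤ I.card * K := by
      have : A ⊆ I ×ˢ (univ : Finset (Fin K)) := by
        intro p hp
        simp only [mem_product, mem_univ, and_true]
        exact mem_image_of_mem _ hp
      have := card_le_card this
      simpa [card_product] using this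
    have e2 : ((I.card * K : ℕ) : ℝ) ≤ ((A.biUnion t).card : ℝ) := by
      calc ((I.card * K : ℕ) : ℝ)
          = ∑ c ∈ I, (K : ℝ) := by simp
        _ ≤ ∑ c ∈ I, ∑ v, w c v :=
            sum_le_sum (fun c _ => h2 c c.2)
        _ = ∑ c ∈ I, ∑ v ∈ A.biUnion t, w c v := by
            refine sum_congr rfl (fun c hc => ?_)
            symm
            refine sum_subset (subset_univ _) (fun v _ hv => ?_)
            by_contra hne
            apply hv
            obtain ⟨p, hp, rfl⟩ := mem_image.1 hc
            exact mem_biUnion.2 ⟨p, hp, by simp [t, hne]⟩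
        _ = ∑ v ∈ A.biUnion t, ∑ c ∈ I, w c v := sum_comm
        _ ≤ ∑ v ∈ A.biUnion t, (1 : ℝ) := by
            refine sum_le_sum (fun v _ => ?_)
            calc ∑ c ∈ I, w c v ≤ ∑ c : ↥C, w c v :=
                  sum_le_sum_of_subset_of_nonneg (subset_univ _) (fun c _ _ => hw c v)
              _ = ∑ c ∈ C, w c v := by
                  exact sum_coe_sort C (fun c => w c v)
              _ ≤ 1 := h1 v
        _ = _ := by simp
    exact e1.trans (by exact_mod_cast e2)
  obtain ⟨g, hg, hgt⟩ := (Finset.all_card_le_biUnion_card_iff_exists_injective t).1 hall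
  refine ⟨fun c => if h : c ∈ C then univ.image (fun i => g (⟨c, h⟩, i)) else ∅, ?_, ?_⟩
  · intro c hc
    simp only [hc, dif_pos]
    constructor
    · rw [card_image_of_injective]
      · simp
      · intro i j hij
        have := hg hij
        simpa using this
    · intro v hv
      obtain ⟨i, -, rfl⟩ := mem_image.1 hv
      have := hgt (⟨c, hc⟩, i)
      simpa [t] using this
  · intro c hc c' hc' v hv hv'
    simp only [hc, hc', dif_pos] at hv hv'
    obtain ⟨i, -, rfl⟩ := mem_image.1 hv
    obtain ⟨j, -, hj⟩ := mem_image.1 hv'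
    have := hg hj
    simp at this
    exact this.1.symm

lemma sf_indep {V α : Type} [Fintype V] [DecidableEq V] [Fintype α] (S : Finset V)
    (A B : (V → α) → Prop) [DecidablePred A] [DecidablePred B]
    (hA : ∀ x y : V → α, (∀ v ∈ S, x v = y v) → A x → A y)
    (hB : ∀ x y : V → α, (∀ v, v ∉ S → x v = y v) → B x → B y) :
    (univ.filter (fun x => A x ∧ B x)).card * Fintype.card (V → α) =
      (univ.filter A).card * (univ.filter B).card := by
  classical
  rw [← card_univ, ← card_product, ← card_product]
  refine card_bij' (fun p _ => (S.piecewise p.1 p.2, S.piecewise p.2 p.1))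
    (fun p _ => (S.piecewise p.1 p.2, S.piecewise p.2 p.1)) ?_ ?_ ?_ ?_
  · rintro ⟨x, y⟩ h
    simp only [mem_product, mem_filter, mem_univ, true_and, and_true] at h ⊢
    exact ⟨hA x _ (fun v hv => by simp [hv]) h.1, hB x _ (fun v hv => by simp [hv]) h.2⟩
  · rintro ⟨x, y⟩ h
    simp only [mem_product, mem_filter, mem_univ, true_and, and_true] at h ⊢
    exact ⟨hA x _ (fun v hv => by simp [hv]) h.1, hB y _ (fun v hv => by simp [hv]) h.2⟩
  · rintro ⟨x, y⟩ h
    ext v <;> by_cases hv : v ∈ S <;> simp [hv]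
  · rintro ⟨x, y⟩ h
    ext v <;> by_cases hv : v ∈ S <;> simp [hv]

lemma sf_lll {V α : Type} [Fintype V] [DecidableEq V] [Fintype α] [Nonempty α]
    (S : V → Finset V) (E : V → (V → α) → Prop)
    (hE : ∀ v, ∀ x y : V → α, (∀ w ∈ S v, x w = y w) → E v x → E v y)
    (q : ℝ) (D : ℝ) (hq : 0 ≤ q) (hq2 : 2 * q < 1) (hqD : 4 * q * D ≤ 1)
    (hp : ∀ v, (Nat.card {x // E v x} : ℝ) ≤ q * Fintype.card (V → α))
    (hD : ∀ v, ((univ.filter (fun u => ¬ Disjoint (S u) (S v))).card : ℝ) ≤ D) :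
    ∃ x : V → α, ∀ v, ¬ E v x := by
  classical
  have hp' : ∀ v, ((univ.filter (E v)).card : ℝ) ≤ q * Fintype.card (V → α) := by
    intro v
    have := hp v
    rwa [Nat.card_eq_fintype_card, Fintype.card_subtype] at this
  have hΩ : (0 : ℝ) < Fintype.card (V → α) := by exact_mod_cast Fintype.card_pos
  let av : Finset V → Finset (V → α) := fun F => univ.filter (fun x => ∀ u ∈ F, ¬ E u x)
  have key : ∀ n : ℕ, ∀ F : Finset V, F.card = n → ∀ v,
      (((univ.filter (fun x => E v x ∧ ∀ u ∈ F, ¬ E u x)).card : ℝ)) ≤ 2 * q * (av F).card := by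
    intro n
    induction n using Nat.strong_induction_on with
    | _ n ih =>
    intro F hF v
    let F1 := F.filter (fun u => ¬ Disjoint (S u) (S v))
    let F2 := F.filter (fun u => Disjoint (S u) (S v))
    have ind := sf_indep (S v) (E v) (fun x => ∀ u ∈ F2, ¬ E u x) (hE v) (by
      intro x y hxy hx u hu hEu
      refine hx u hu (hE u y x (fun w hw => ?_) hEu)
      refine (hxy w (fun hw' => ?_)).symm
      exact (Finset.disjoint_left.1 (mem_filter.1 hu).2) hw hw')
    have b1 : ((univ.filter (fun x => E v x ∧ ∀ u ∈ F2, ¬ E u x)).card : ℝ)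
        ≤ q * (av F2).card := by
      have i2 : ((univ.filter (fun x => E v x ∧ ∀ u ∈ F2, ¬ E u x)).card : ℝ)
        * Fintype.card (V → α) = (univ.filter (E v)).card * (av F2).card := by
        exact_mod_cast ind
      have := mul_le_mul_of_nonneg_right (hp' v) (Nat.cast_nonneg (α := ℝ) (av F2).card)
      rw [← i2] at this
      nlinarith
    have b0 : ((univ.filter (fun x => E v x ∧ ∀ u ∈ F, ¬ E u x)).card : ℝ) ≤
        ((univ.filter (fun x => E v x ∧ ∀ u ∈ F2, ¬ E u x)).card : ℝ) := by
      exact_mod_cast card_le_card (by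
        intro x hx
        simp only [mem_filter, mem_univ, true_and] at hx ⊢
        exact ⟨hx.1, fun u hu => hx.2 u (mem_filter.1 hu).1⟩)
    have b2 : ((av F2).card : ℝ) ≤ 2 * (av F).card := by
      rcases F1.eq_empty_or_nonempty with h | h
      · have : F2 = F := by
          apply filter_true_of_mem
          intro u hu
          by_contra hc
          have : u ∈ F1 := mem_filter.2 ⟨hu, hc⟩
          simp [h] at this
        rw [this]
        have : (0:ℝ) ≤ (av F).card := Nat.cast_nonneg _
        linarith
      · have hlt : F2.card < n := by
          rw [← hF]
          apply card_lt_card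
          refine ⟨filter_subset _ _, fun hs => ?_⟩
          obtain ⟨u, hu⟩ := h
          exact (mem_filter.1 hu).2 (mem_filter.1 (hs (mem_filter.1 hu).1)).2
        have hsub : av F2 ⊆ av F ∪ F1.biUnion
            (fun u => univ.filter (fun x => E u x ∧ ∀ u ∈ F2, ¬ E u x)) := by
          intro x hx
          simp only [av, mem_union, mem_filter, mem_univ, true_and, mem_biUnion] at hx ⊢
          by_cases hh : ∀ u ∈ F, ¬ E u x
          · exact Or.inl hh
          · push Not at hh
            obtain ⟨u, hu, hEu⟩ := hh
            refine Or.inr ⟨u, ?_, hEu, hx⟩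
            by_contra hc
            refine hx u ?_ hEu
            refine mem_filter.2 ⟨hu, ?_⟩
            by_contra hd
            exact hc (mem_filter.2 ⟨hu, hd⟩)
        have c1 := (card_le_card hsub).trans (card_union_le _ _)
        have c2 := c1.trans (Nat.add_le_add_left card_biUnion_le _)
        have c3 : ((av F2).card : ℝ) ≤ (av F).card + ∑ u ∈ F1,
            ((univ.filter (fun x => E u x ∧ ∀ u ∈ F2, ¬ E u x)).card : ℝ) := by
          exact_mod_cast c2
        have c4 : ∑ u ∈ F1,
            ((univ.filter (fun x => E u x ∧ ∀ u ∈ F2, ¬ E u x)).card : ℝ) ≤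
            F1.card * (2 * q * (av F2).card) := by
          rw [← nsmul_eq_mul]
          exact sum_le_card_nsmul _ _ _ (fun u _ => ih _ hlt F2 rfl u)
        have c5 : (F1.card : ℝ) ≤ D := by
          refine le_trans ?_ (hD v)
          exact_mod_cast card_le_card (by
            intro u hu
            simpa using (mem_filter.1 hu).2)
        have c6 : (F1.card : ℝ) * (2 * q * (av F2).card) ≤ (1/2) * (av F2).card := by
          have : (F1.card : ℝ) * (2 * q) ≤ 1 / 2 := by nlinarith
          have h0 : (0:ℝ) ≤ (av F2).card := Nat.cast_nonneg _
          nlinarith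
        linarith
    nlinarith
  have pos : ∀ F : Finset V, (0:ℝ) < (av F).card := by
    intro F
    induction F using Finset.induction_on with
    | empty =>
      simp only [av, notMem_empty, false_imp_iff, implies_true, filter_true, card_univ]
      simpa using hΩ
    | insert v F hv ih =>
      have hsub : av F ⊆ av (insert v F) ∪ univ.filter (fun x => E v x ∧ ∀ u ∈ F, ¬ E u x) := by
        intro x hx
        simp only [av, mem_union, mem_filter, mem_univ, true_and, mem_insert, forall_eq_or_imp] at hx ⊢
        by_cases h : E v x
        · exact Or.inr ⟨h, hx⟩
        · exact Or.inl ⟨h, hx⟩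
      have c1 := (card_le_card hsub).trans (card_union_le _ _)
      have c2 : ((av F).card : ℝ) ≤ (av (insert v F)).card +
        ((univ.filter (fun x => E v x ∧ ∀ u ∈ F, ¬ E u x)).card : ℝ) := by exact_mod_cast c1
      have := key _ F rfl v
      nlinarith
  have := pos univ
  obtain ⟨x, hx⟩ := card_pos.1 (by exact_mod_cast this : 0 < (av univ).card)
  exact ⟨x, fun v => (mem_filter.1 hx).2 v (mem_univ v)⟩

lemma sf_moment {V : Type} [Fintype V] [DecidableEq V] (N : ℕ) [NeZero N] (S : Finset V)
    (l : ℝ) (hl : 0 ≤ l) :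
    ∑ x : V → Fin N, l ^ (S.filter (fun v => x v = 0)).card ≤
      Fintype.card (V → Fin N) * Real.exp ((l - 1) * S.card / N) := by
  have hN : (0:ℝ) < N := by exact_mod_cast NeZero.pos N
  have e1 : ∀ x : V → Fin N, l ^ (S.filter (fun v => x v = 0)).card =
      ∏ v, (if v ∈ S ∧ x v = 0 then l else 1) := by
    intro x
    rw [prod_ite, prod_const, prod_const_one, mul_one]
    congr 2
    ext v; simp
  have e2 : ∀ v, ∑ c : Fin N, (if v ∈ S ∧ c = 0 then l else 1) =
      N * (if v ∈ S then 1 + (l-1)/N else 1) := by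
    intro v
    by_cases hv : v ∈ S
    · simp only [hv, true_and, if_true]
      have : ∀ c : Fin N, (if c = 0 then l else 1) = (if c = 0 then l - 1 else 0) + 1 := by
        intro c; split_ifs <;> ring
      simp only [this, sum_add_distrib, sum_ite_eq', mem_univ, if_true]
      simp
      field_simp
      ring
    · simp [hv]
  simp only [e1]
  have e3 := Finset.prod_univ_sum (fun _ : V => (univ : Finset (Fin N)))
    (fun v c => (if v ∈ S ∧ c = 0 then l else (1:ℝ)))
  rw [Fintype.piFinset_univ] at e3
  rw [← e3]
  simp only [e2]
  rw [prod_mul_distrib, prod_const, prod_ite, prod_const, prod_const_one, mul_one]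
  have : ((Fintype.card (V → Fin N) : ℕ) : ℝ) = (N:ℝ) ^ (univ : Finset V).card := by
    simp
  rw [this]
  refine mul_le_mul_of_nonneg_left ?_ (by positivity)
  have h0 : 0 ≤ 1 + (l-1)/N := by
    have : (1:ℝ) ≤ N := by exact_mod_cast NeZero.one_le
    have : 1 + (l-1)/N = (N - 1 + l) / N := by field_simp; ring
    rw [this]; apply div_nonneg <;> linarith
  have hc : (univ.filter (fun v => v ∈ S)).card = S.card := by congr 1; ext; simp
  rw [hc]
  calc (1 + (l-1)/N) ^ S.card ≤ (Real.exp ((l-1)/N)) ^ S.card := by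
        refine pow_le_pow_left₀ h0 ?_ _
        have := Real.add_one_le_exp ((l-1)/N)
        linarith
    _ = _ := by rw [← Real.exp_nat_mul]; congr 1; ring

lemma sf_random {V : Type} [Fintype V] [DecidableEq V] (N T : ℕ) (hN : 1 ≤ N) (hT : 1 ≤ T)
    (S : V → Finset V) (t : V → ℕ) (q : ℝ) (hq : 0 < q) (hqT : 8 * q * T ^ 2 ≤ 1)
    (hS : ∀ v, (S v).card ≤ T) (hS' : ∀ w, (univ.filter (fun v => w ∈ S v)).card ≤ T)
    (ht : ∀ v, Real.exp ((S v).card / N) ≤ q * 2 ^ (t v)) :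
    ∃ R : Finset V, ∀ v, ((S v).filter (· ∈ R)).card < t v ∧
      (Real.exp (-((S v).card / N)) ≤ q → ∃ w ∈ S v, w ∈ R) := by
  classical
  have : NeZero N := ⟨by omega⟩
  let E : V → (V → Fin N) → Prop := fun v x =>
    t v ≤ ((S v).filter (fun w => x w = 0)).card ∨
    (Real.exp (-((S v).card / N)) ≤ q ∧ ((S v).filter (fun w => x w = 0)).card = 0)
  have hT1 : (1:ℝ) ≤ T := by exact_mod_cast hT
  obtain ⟨x, hx⟩ := sf_lll S E (by
      intro v x y hxy h
      have : (S v).filter (fun w => x w = 0) = (S v).filter (fun w => y w = 0) := by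
        apply filter_congr
        intro w hw
        rw [hxy w hw]
      simpa only [E, this] using h) (2 * q) (T ^ 2) (by linarith) (by nlinarith) (by nlinarith)
      (by
        intro v
        rw [Nat.card_eq_fintype_card, Fintype.card_subtype]
        have h1 : ((univ.filter (fun x : V → Fin N =>
            t v ≤ ((S v).filter (fun w => x w = 0)).card)).card : ℝ) ≤
            q * Fintype.card (V → Fin N) := by
          have m := sf_moment N (S v) 2 (by norm_num)
          have : ((univ.filter (fun x : V → Fin N =>
            t v ≤ ((S v).filter (fun w => x w = 0)).card)).card : ℝ) * 2 ^ (t v) ≤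
            ∑ x : V → Fin N, (2:ℝ) ^ ((S v).filter (fun v => x v = 0)).card := by
            rw [← nsmul_eq_mul]
            refine (card_nsmul_le_sum _ (fun x : V → Fin N => (2:ℝ) ^ ((S v).filter (fun v => x v = 0)).card) _ ?_).trans
              (sum_le_sum_of_subset_of_nonneg (subset_univ _) (fun _ _ _ => by positivity))
            intro x hx
            exact pow_le_pow_right₀ (by norm_num) (mem_filter.1 hx).2
          have m2 := this.trans m
          have e : ((2:ℝ) - 1) * (S v).card / N = (S v).card / N := by ring
          rw [e] at m2
          have m3 := m2.trans (mul_le_mul_of_nonneg_left (ht v) (Nat.cast_nonneg _))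
          have hp : (0:ℝ) < 2 ^ t v := by positivity
          refine le_of_mul_le_mul_right ?_ hp
          linarith
        have h2 : ((univ.filter (fun x : V → Fin N => (Real.exp (-((S v).card / N)) ≤ q ∧
            ((S v).filter (fun w => x w = 0)).card = 0))).card : ℝ) ≤
            q * Fintype.card (V → Fin N) := by
          by_cases hh : Real.exp (-((S v).card / N)) ≤ q
          · have m := sf_moment N (S v) 0 le_rfl
            have e : ((0:ℝ) - 1) * (S v).card / N = -((S v).card / N) := by ring
            rw [e] at m
            simp only [hh, true_and]
            have : ((univ.filter (fun x : V → Fin N =>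
              ((S v).filter (fun w => x w = 0)).card = 0)).card : ℝ) ≤
              ∑ x : V → Fin N, (0:ℝ) ^ ((S v).filter (fun v => x v = 0)).card := by
              rw [card_filter]
              push_cast
              refine sum_le_sum (fun x _ => ?_)
              split_ifs with h
              · simp [h]
              · positivity
            refine (this.trans m).trans ?_
            rw [mul_comm]
            exact mul_le_mul_of_nonneg_right hh (Nat.cast_nonneg _)
          · simp only [hh, false_and, filter_false, card_empty, Nat.cast_zero]
            positivity
        have h3 : (univ.filter (E v)).card ≤ _ + _ := (by
          rw [filter_or]; exact card_union_le _ _)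
        have h4 := (Nat.cast_le (α := ℝ)).2 h3
        push_cast at h4
        linarith)
      (by
        intro v
        have : univ.filter (fun u => ¬ Disjoint (S u) (S v)) ⊆
            (S v).biUnion (fun w => univ.filter (fun u => w ∈ S u)) := by
          intro u hu
          simp only [mem_filter, mem_univ, true_and, Finset.not_disjoint_iff] at hu
          obtain ⟨w, h1, h2⟩ := hu
          simp only [mem_biUnion, mem_filter, mem_univ, true_and]
          exact ⟨w, h2, h1⟩
        have h2 := (card_le_card this).trans (card_biUnion_le_card_mul _ _ T (fun w _ => hS' w))
        have h3 := h2.trans (Nat.mul_le_mul_right T (hS v))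
        have : ((univ.filter (fun u => ¬ Disjoint (S u) (S v))).card : ℝ) ≤ T * T := by
          exact_mod_cast h3
        rw [sq]; exact this)
  refine ⟨univ.filter (fun v => x v = 0), fun v => ?_⟩
  have := hx v
  simp only [E, not_or, not_le, not_and] at this
  simp only [mem_filter, mem_univ, true_and]
  refine ⟨this.1, fun h => ?_⟩
  have h2 := this.2 h
  obtain ⟨w, hw⟩ := card_pos.1 (Nat.pos_of_ne_zero h2)
  exact ⟨w, (mem_filter.1 hw).1, (mem_filter.1 hw).2⟩

lemma sf_core {V : Type} [Fintype V] [DecidableEq V] (nb : V → Finset V)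
    (sym : ∀ v w, w ∈ nb v → v ∈ nb w) (irr : ∀ v, v ∉ nb v) (d k m N : ℕ) (q : ℝ)
    (hd : 1 ≤ d) (hk : 1 ≤ k) (hm : 1 ≤ m) (hN : 1 ≤ N)
    (hdeg : ∀ v, d ≤ (nb v).card)
    (hmin : ∀ v w, w ∈ nb v → (nb v).card ≤ d ∨ (nb w).card ≤ d)
    (hq : 0 < q) (hqT : 8 * q * (5 * k * d : ℝ) ^ 2 ≤ 1)
    (h1 : Real.exp (-((d / 2 : ℝ) / N)) ≤ q)
    (h2 : Real.exp ((5 * k * d : ℝ) / N) ≤ q * 2 ^ m)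
    (h3 : Real.exp ((5 * k : ℝ) / N) ≤ q * 2 ^ (2 * k))
    (h4 : 6 * k * (m * (3 * k + 1)) ≤ d) :
    ∃ (C : Finset V) (f : V → V), (∀ v, v ∉ C → f v ∈ C ∧ f v ∈ nb v) ∧
      ∀ c ∈ C, k ≤ (univ.filter (fun v => v ∉ C ∧ f v = c)).card := by
  classical
  obtain ⟨T, hTdef⟩ : ∃ T, T = 5 * k * d := ⟨_, rfl⟩
  obtain ⟨s, hsdef⟩ : ∃ s, s = m * (3 * k + 1) := ⟨_, rfl⟩
  have hdT : d < T := by rw [hTdef]; nlinarith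
  have hNpos : (0:ℝ) < N := by exact_mod_cast hN
  have hdpos : (0:ℝ) < d := by exact_mod_cast hd
  have hmpos : (0:ℝ) < m := by exact_mod_cast hm
  have hkpos : (0:ℝ) < k := by exact_mod_cast hk
  let X : Finset V := univ.filter (fun v => T ≤ (nb v).card)
  have mX : ∀ v, v ∈ X ↔ T ≤ (nb v).card := by simp [X]
  have hXnb : ∀ x ∈ X, ∀ v ∈ nb x, (nb v).card ≤ d := by
    intro x hx v hv
    rcases hmin x v hv with h | h
    · have := (mX x).1 hx; omega
    · exact h
  -- private sets for the vertices of huge degree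
  obtain ⟨P, hP, hPd⟩ := sf_whall X (fun x v => if v ∈ nb x then (1 / d : ℝ) else 0)
    (fun c v => by split_ifs <;> positivity) (5 * k)
    (by
      intro v
      rw [← sum_filter, sum_const, nsmul_eq_mul]
      have : (X.filter (fun x => v ∈ nb x)).card ≤ d := by
        rcases (X.filter (fun x => v ∈ nb x)).eq_empty_or_nonempty with h | ⟨x, hx⟩
        · rw [h]; simp
        · have hx' := mem_filter.1 hx
          refine le_trans (card_le_card ?_) (hXnb x hx'.1 v hx'.2)
          intro y hy
          exact sym _ _ (mem_filter.1 hy).2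
      have h' : ((X.filter (fun x => v ∈ nb x)).card : ℝ) ≤ d := by exact_mod_cast this
      rw [mul_one_div, div_le_one hdpos]
      exact h')
    (by
      intro x hx
      rw [← sum_filter, sum_const, nsmul_eq_mul, mul_one_div, le_div_iff₀ hdpos]
      have e : univ.filter (fun v => v ∈ nb x) = nb x := by ext; simp
      rw [e]
      have := (mX x).1 hx
      rw [hTdef] at this
      exact_mod_cast this)
  have hPnb : ∀ x ∈ X, ∀ v ∈ P x, v ∈ nb x := by
    intro x hx v hv
    have := (hP x hx).2 v hv
    by_contra h
    simp [h] at this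
  let U : Finset V := univ.filter (fun v => v ∉ X ∧ ∀ x ∈ nb v, x ∉ X)
  have mU : ∀ v, v ∈ U ↔ (v ∉ X ∧ ∀ x ∈ nb v, x ∉ X) := by simp [U]
  let Q : Finset V := univ.filter (fun v => v ∉ X ∧ s ≤ (nb v ∩ U).card)
  have mQ : ∀ v, v ∈ Q ↔ (v ∉ X ∧ s ≤ (nb v ∩ U).card) := by simp [Q]
  let S : V → Finset V := fun v => if v ∈ X then P v ∩ Q else nb v ∩ Q
  have hSnb : ∀ v, S v ⊆ nb v ∩ Q := by
    intro v w hw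
    by_cases hv : v ∈ X
    · simp only [S, hv, if_true, mem_inter] at hw
      exact mem_inter.2 ⟨hPnb v hv w hw.1, hw.2⟩
    · simpa only [S, hv, if_false] using hw
  have hSX : ∀ v ∈ X, (S v).card ≤ 5 * k := by
    intro v hv
    simp only [S, hv, if_true]
    rw [← (hP v hv).1]
    exact card_le_card inter_subset_left
  have hSL : ∀ v, v ∉ X → (S v).card ≤ T := by
    intro v hv
    have := card_le_card ((hSnb v).trans inter_subset_left)
    have h := (mX v).not.1 hv
    omega
  have h5kT : 5 * k ≤ T := by rw [hTdef]; nlinarith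
  obtain ⟨R0, hR0⟩ := sf_random N T hN (by omega) S (fun v => if v ∈ X then 2 * k else m) q hq
    (by rw [hTdef]; push_cast; exact hqT)
    (by
      intro v
      by_cases hv : v ∈ X
      · exact (hSX v hv).trans h5kT
      · exact hSL v hv)
    (by
      intro w
      by_cases hw : w ∈ Q
      · have h := (mX w).not.1 ((mQ w).1 hw).1
        refine le_trans (card_le_card ?_) (by omega : (nb w).card ≤ T)
        intro v hv
        exact sym _ _ (mem_inter.1 (hSnb v (mem_filter.1 hv).2)).1
      · rw [filter_false_of_mem]
        · simp
        · intro v _ h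
          exact hw (mem_inter.1 (hSnb v h)).2)
    (by
      intro v
      by_cases hv : v ∈ X
      · simp only [hv, if_true]
        refine le_trans (Real.exp_le_exp.2 ?_) h3
        refine div_le_div_of_nonneg_right ?_ hNpos.le
        exact_mod_cast hSX v hv
      · simp only [hv, if_false]
        refine le_trans (Real.exp_le_exp.2 ?_) h2
        refine div_le_div_of_nonneg_right ?_ hNpos.le
        have := hSL v hv
        rw [hTdef] at this
        exact_mod_cast this)
  let R : Finset V := R0 ∩ Q
  have mR : ∀ v, v ∈ R ↔ v ∈ R0 ∧ v ∈ Q := by simp [R]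
  have hRlow : ∀ v, v ∉ X → (nb v ∩ R).card < m := by
    intro v hv
    have := (hR0 v).1
    simp only [S, hv, if_false] at this
    refine lt_of_le_of_lt (card_le_card ?_) this
    intro w hw
    simp only [mem_inter, mR, mem_filter] at hw ⊢
    tauto
  have hRX : ∀ v ∈ X, (P v ∩ R).card < 2 * k := by
    intro v hv
    have := (hR0 v).1
    simp only [S, hv, if_true] at this
    refine lt_of_le_of_lt (card_le_card ?_) this
    intro w hw
    simp only [mem_inter, mR, mem_filter] at hw ⊢
    tauto
  have hRdom : ∀ v, v ∉ X → d ≤ 2 * (nb v ∩ Q).card → ∃ w ∈ nb v, w ∈ R := by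
    intro v hv hc
    have := (hR0 v).2
    simp only [S, hv, if_false] at this
    obtain ⟨w, hw, hw'⟩ := this (by
      refine le_trans (Real.exp_le_exp.2 ?_) h1
      refine neg_le_neg (div_le_div_of_nonneg_right ?_ hNpos.le)
      have : (d:ℝ) ≤ 2 * (nb v ∩ Q).card := by exact_mod_cast hc
      linarith)
    have hw := mem_inter.1 hw
    exact ⟨w, hw.1, (mR w).2 ⟨hw', hw.2⟩⟩
  have hRnX : ∀ v ∈ R, v ∉ X := fun v hv => ((mQ v).1 ((mR v).1 hv).2).1
  let D : Finset V := univ.filter (fun u => u ∈ U ∧ u ∉ R ∧ ∀ w ∈ nb u, w ∉ R)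
  have mD : ∀ v, v ∈ D ↔ (v ∈ U ∧ v ∉ R ∧ ∀ w ∈ nb v, w ∉ R) := by simp [D]
  -- a maximal independent subset of D
  obtain ⟨I, hI, hImax⟩ := Finset.exists_max_image
    (D.powerset.filter (fun A => ∀ a ∈ A, ∀ b ∈ A, b ∉ nb a)) (fun A => A.card)
    ⟨∅, by simp⟩
  simp only [mem_filter, mem_powerset] at hI hImax
  obtain ⟨hID, hIind⟩ := hI
  have hIU : ∀ v ∈ I, v ∈ U := fun v hv => ((mD v).1 (hID hv)).1
  have hIdom : ∀ v ∈ D, v ∉ I → ∃ c ∈ I, c ∈ nb v := by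
    intro v hv hvI
    by_contra hcon
    push Not at hcon
    have := hImax (insert v I) ⟨?_, ?_⟩
    · rw [card_insert_of_notMem hvI] at this
      omega
    · exact insert_subset hv hID
    · intro a ha b hb hab
      rcases mem_insert.1 ha with h | ha'
      · rcases mem_insert.1 hb with h' | hb'
        · rw [h, h'] at hab
          exact irr _ hab
        · rw [h] at hab
          exact hcon b hb' hab
      · rcases mem_insert.1 hb with h' | hb'
        · rw [h'] at hab
          exact hcon a ha' (sym _ _ hab)
        · exact hIind a ha' b hb' hab
  let C : Finset V := X ∪ (R ∪ I)
  have mC : ∀ v, v ∈ C ↔ (v ∈ X ∨ v ∈ R ∨ v ∈ I) := by simp [C]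
  have hdom : ∀ v, v ∉ C → ∃ c ∈ C, c ∈ nb v := by
    intro v hv
    by_contra hcon
    push Not at hcon
    simp only [mC, not_or] at hv
    have hvU : v ∈ U := (mU v).2 ⟨hv.1, fun x hx hxX => hcon x ((mC x).2 (Or.inl hxX)) hx⟩
    have hvD : v ∈ D := (mD v).2 ⟨hvU, hv.2.1,
      fun x hx hxR => hcon x ((mC x).2 (Or.inr (Or.inl hxR))) hx⟩
    obtain ⟨c, hc, hc'⟩ := hIdom v hvD hv.2.2
    exact hcon c ((mC c).2 (Or.inr (Or.inr hc))) hc'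
  have hspos : (0:ℝ) < s := by
    rw [hsdef]; push_cast; positivity
  let wa : V → V → ℝ := fun c v => if c ∈ X ∧ v ∈ P c ∧ v ∉ R then 1 / 3 else 0
  let wb : V → V → ℝ := fun c v => if c ∈ R ∧ v ∈ nb c ∧ v ∈ U ∧ v ∉ R then 1 / (3 * m) else 0
  let we : V → V → ℝ := fun c v => if c ∈ I ∧ v ∈ nb c ∧ v ∉ Q then 1 / (3 * s) else 0
  have wa0 : ∀ c v, 0 ≤ wa c v := fun c v => by
    simp only [wa]; split_ifs <;> positivity
  have wb0 : ∀ c v, 0 ≤ wb c v := fun c v => by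
    simp only [wb]; split_ifs <;> positivity
  have we0 : ∀ c v, 0 ≤ we c v := fun c v => by
    simp only [we]; split_ifs <;> positivity
  obtain ⟨F, hF, hFd⟩ := sf_whall C (fun c v => wa c v + wb c v + we c v)
    (fun c v => by have := wa0 c v; have := wb0 c v; have := we0 c v; positivity) k
    (by
      intro v
      rw [sum_add_distrib, sum_add_distrib]
      have ba : ∑ c ∈ C, wa c v ≤ 1 / 3 := by
        simp only [wa]
        rw [← sum_filter, sum_const, nsmul_eq_mul]
        have : (C.filter (fun c => c ∈ X ∧ v ∈ P c ∧ v ∉ R)).card ≤ 1 := by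
          rw [card_le_one]
          intro a ha b hb
          simp only [mem_filter] at ha hb
          exact hPd a ha.2.1 b hb.2.1 v ha.2.2.1 hb.2.2.1
        have : ((C.filter (fun c => c ∈ X ∧ v ∈ P c ∧ v ∉ R)).card : ℝ) ≤ 1 := by
          exact_mod_cast this
        linarith
      have bb : ∑ c ∈ C, wb c v ≤ 1 / 3 := by
        simp only [wb]
        rw [← sum_filter, sum_const, nsmul_eq_mul]
        have : (C.filter (fun c => c ∈ R ∧ v ∈ nb c ∧ v ∈ U ∧ v ∉ R)).card ≤ m := by
          by_cases hv : v ∈ U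
          · refine le_trans (card_le_card ?_) (hRlow v ((mU v).1 hv).1).le
            intro c hc
            simp only [mem_filter] at hc
            exact mem_inter.2 ⟨sym _ _ hc.2.2.1, hc.2.1⟩
          · rw [filter_false_of_mem]
            · simp
            · intro c _ h
              exact hv h.2.2.1
        have : ((C.filter (fun c => c ∈ R ∧ v ∈ nb c ∧ v ∈ U ∧ v ∉ R)).card : ℝ) ≤ m := by
          exact_mod_cast this
        rw [mul_one_div, div_le_div_iff₀ (by positivity) (by norm_num)]
        linarith
      have be : ∑ c ∈ C, we c v ≤ 1 / 3 := by
        simp only [we]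
        rw [← sum_filter, sum_const, nsmul_eq_mul]
        have : (C.filter (fun c => c ∈ I ∧ v ∈ nb c ∧ v ∉ Q)).card ≤ s := by
          rcases (C.filter (fun c => c ∈ I ∧ v ∈ nb c ∧ v ∉ Q)).eq_empty_or_nonempty with h | ⟨c, hc⟩
          · rw [h]; simp
          · simp only [mem_filter] at hc
            have hvX : v ∉ X := ((mU c).1 (hIU c hc.2.1)).2 v hc.2.2.1
            have hvs : (nb v ∩ U).card < s := by
              by_contra h
              exact hc.2.2.2 ((mQ v).2 ⟨hvX, not_lt.1 h⟩)
            refine le_trans (card_le_card ?_) hvs.le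
            intro b hb
            simp only [mem_filter] at hb
            exact mem_inter.2 ⟨sym _ _ hb.2.2.1, hIU b hb.2.1⟩
        have : ((C.filter (fun c => c ∈ I ∧ v ∈ nb c ∧ v ∉ Q)).card : ℝ) ≤ s := by
          exact_mod_cast this
        rw [mul_one_div, div_le_div_iff₀ (by positivity) (by norm_num)]
        linarith
      linarith)
    (by
      intro c hc
      rw [sum_add_distrib, sum_add_distrib]
      have za : 0 ≤ ∑ v, wa c v := sum_nonneg (fun v _ => wa0 c v)
      have zb : 0 ≤ ∑ v, wb c v := sum_nonneg (fun v _ => wb0 c v)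
      have ze : 0 ≤ ∑ v, we c v := sum_nonneg (fun v _ => we0 c v)
      rcases (mC c).1 hc with hc | hc | hc
      · have : (k:ℝ) ≤ ∑ v, wa c v := by
          simp only [wa, hc, true_and]
          rw [← sum_filter, sum_const, nsmul_eq_mul]
          have e : univ.filter (fun v => v ∈ P c ∧ v ∉ R) = P c \ R := by ext; simp
          rw [e]
          have h5 := card_sdiff_add_card_inter (P c) R
          have h6 := hRX c hc
          have h7 := (hP c hc).1
          have : 3 * k ≤ (P c \ R).card := by omega
          have : 3 * (k:ℝ) ≤ (P c \ R).card := by exact_mod_cast this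
          linarith
        linarith
      · have : (k:ℝ) ≤ ∑ v, wb c v := by
          simp only [wb, hc, true_and]
          rw [← sum_filter, sum_const, nsmul_eq_mul]
          have e : univ.filter (fun v => v ∈ nb c ∧ v ∈ U ∧ v ∉ R) = (nb c ∩ U) \ R := by
            ext; simp [and_assoc]
          rw [e]
          have h5 := card_sdiff_add_card_inter (nb c ∩ U) R
          have h6 := hRlow c (hRnX c hc)
          have h7 := ((mQ c).1 ((mR c).1 hc).2).2
          have h8 : ((nb c ∩ U) ∩ R).card ≤ (nb c ∩ R).card := by
            apply card_le_card
            intro v hv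
            simp only [mem_inter] at hv ⊢
            tauto
          have h9 : s = 3 * k * m + m := by rw [hsdef]; ring
          have : 3 * k * m ≤ ((nb c ∩ U) \ R).card := by omega
          have : 3 * (k:ℝ) * m ≤ ((nb c ∩ U) \ R).card := by exact_mod_cast this
          rw [mul_one_div, le_div_iff₀ (by positivity)]
          linarith
        linarith
      · have : (k:ℝ) ≤ ∑ v, we c v := by
          simp only [we, hc, true_and]
          rw [← sum_filter, sum_const, nsmul_eq_mul]
          have e : univ.filter (fun v => v ∈ nb c ∧ v ∉ Q) = nb c \ Q := by
            ext; simp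
          rw [e]
          have h5 := card_sdiff_add_card_inter (nb c) Q
          have hcD := (mD c).1 (hID hc)
          have h6 : 2 * (nb c ∩ Q).card < d := by
            by_contra h
            obtain ⟨w, hw, hw'⟩ := hRdom c ((mU c).1 hcD.1).1 (not_lt.1 h)
            exact hcD.2.2 w hw hw'
          have h7 := hdeg c
          rw [← hsdef] at h4
          have : 6 * k * s ≤ 2 * (nb c \ Q).card := by omega
          have : 6 * (k:ℝ) * s ≤ 2 * (nb c \ Q).card := by exact_mod_cast this
          rw [mul_one_div, le_div_iff₀ (by positivity)]
          linarith
        linarith)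
  have hFC : ∀ c ∈ C, ∀ v ∈ F c, v ∉ C ∧ v ∈ nb c := by
    intro c hc v hv
    have hne := (hF c hc).2 v hv
    by_cases ha : c ∈ X ∧ v ∈ P c ∧ v ∉ R
    · have hvn := hPnb c ha.1 v ha.2.1
      refine ⟨fun h => ?_, hvn⟩
      rcases (mC v).1 h with h | h | h
      · have := hXnb c ha.1 v hvn
        have := (mX v).1 h
        omega
      · exact ha.2.2 h
      · exact ((mU v).1 (hIU v h)).2 c (sym _ _ hvn) ha.1
    by_cases hb : c ∈ R ∧ v ∈ nb c ∧ v ∈ U ∧ v ∉ R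
    · refine ⟨fun h => ?_, hb.2.1⟩
      rcases (mC v).1 h with h | h | h
      · exact ((mU v).1 hb.2.2.1).1 h
      · exact hb.2.2.2 h
      · exact ((mD v).1 (hID h)).2.2 c (sym _ _ hb.2.1) hb.1
    by_cases he : c ∈ I ∧ v ∈ nb c ∧ v ∉ Q
    · refine ⟨fun h => ?_, he.2.1⟩
      rcases (mC v).1 h with h | h | h
      · exact ((mU c).1 (hIU c he.1)).2 v he.2.1 h
      · exact he.2.2 ((mR v).1 h).2
      · exact hIind c he.1 v h he.2.1
    exfalso
    apply hne
    simp only [wa, wb, we, ha, hb, he, if_false]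
    norm_num
  choose! g hg using hdom
  refine ⟨C, fun v => if h : ∃ c ∈ C, v ∈ F c then h.choose else g v, ?_, ?_⟩
  · intro v hv
    by_cases h : ∃ c ∈ C, v ∈ F c
    · simp only [h, dif_pos]
      have hs := h.choose_spec
      exact ⟨hs.1, sym _ _ (hFC _ hs.1 v hs.2).2⟩
    · simp only [h, dif_neg, not_false_eq_true]
      exact hg v hv
  · intro c hc
    rw [← (hF c hc).1]
    apply card_le_card
    intro v hv
    have h : ∃ c ∈ C, v ∈ F c := ⟨c, hc, hv⟩
    simp only [mem_filter, mem_univ, true_and]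
    refine ⟨(hFC c hc v hv).1, ?_⟩
    rw [dif_pos h]
    exact hFd _ h.choose_spec.1 c hc v h.choose_spec.2 hv

lemma sf_minimal {V : Type} [Fintype V] [DecidableEq V] (G : SimpleGraph V) [DecidableRel G.Adj]
    (d : ℕ) (hG : ∀ v, d ≤ G.degree v) :
    ∃ nb : V → Finset V, (∀ v w, w ∈ nb v → G.Adj v w) ∧ (∀ v w, w ∈ nb v → v ∈ nb w) ∧
      (∀ v, d ≤ (nb v).card) ∧
      (∀ v w, w ∈ nb v → (nb v).card ≤ d ∨ (nb w).card ≤ d) := by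
  classical
  let good : Set (V → Finset V) := {nb | (∀ v w, w ∈ nb v → G.Adj v w) ∧
    (∀ v w, w ∈ nb v → v ∈ nb w) ∧ (∀ v, d ≤ (nb v).card)}
  have hne : good.Nonempty := by
    refine ⟨fun v => G.neighborFinset v, ?_, ?_, ?_⟩
    · intro v w h; simpa using h
    · intro v w h
      simp only [SimpleGraph.mem_neighborFinset] at h ⊢
      exact h.symm
    · intro v; simpa using hG v
  obtain ⟨nb, hnb, hmin⟩ := (Set.toFinite good).exists_minimal hne
  refine ⟨nb, hnb.1, hnb.2.1, hnb.2.2, ?_⟩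
  intro a b hab
  by_contra hcon
  push Not at hcon
  have hba := hnb.2.1 a b hab
  let nb' : V → Finset V := fun v => (nb v).filter (fun w => ¬ ((v = a ∧ w = b) ∨ (v = b ∧ w = a)))
  have hle : nb' ≤ nb := fun v => filter_subset _ _
  have hg : nb' ∈ good := by
    refine ⟨fun v w h => hnb.1 v w (hle v h), ?_, ?_⟩
    · intro v w h
      simp only [nb', mem_filter] at h ⊢
      exact ⟨hnb.2.1 v w h.1, by tauto⟩
    · intro v
      have hab' : a ≠ b := (hnb.1 a b hab).ne
      by_cases hva : v = a
      · subst hva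
        have : (nb v).erase b ⊆ nb' v := by
          intro w hw
          simp only [mem_erase, nb', mem_filter] at hw ⊢
          refine ⟨hw.2, ?_⟩
          rintro (h | h)
          · exact hw.1 h.2
          · exact hab' h.1
        have := card_le_card this
        rw [card_erase_of_mem hab] at this
        omega
      · by_cases hvb : v = b
        · subst hvb
          have : (nb v).erase a ⊆ nb' v := by
            intro w hw
            simp only [mem_erase, nb', mem_filter] at hw ⊢
            refine ⟨hw.2, ?_⟩
            rintro (h | h)
            · exact hva h.1
            · exact hw.1 h.2
          have := card_le_card this
          rw [card_erase_of_mem hba] at this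
          omega
        · have : nb' v = nb v := by
            simp [nb', hva, hvb]
          rw [this]; exact hnb.2.2 v
  have := hmin hg hle a hab
  simp [nb'] at this

set_option maxHeartbeats 1000000 in
lemma sf_numeric : ∃ d₀ : ℕ, ∀ d : ℕ, d₀ ≤ d → ∃ (k m N : ℕ) (q : ℝ),
    1 / 40 * ((d : ℝ) / Real.log d) ^ ((1 : ℝ) / 3) ≤ k ∧
    1 ≤ d ∧ 1 ≤ k ∧ 1 ≤ m ∧ 1 ≤ N ∧ 0 < q ∧ 8 * q * (5 * k * d : ℝ) ^ 2 ≤ 1 ∧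
    Real.exp (-((d / 2 : ℝ) / N)) ≤ q ∧
    Real.exp ((5 * k * d : ℝ) / N) ≤ q * 2 ^ m ∧
    Real.exp ((5 * k : ℝ) / N) ≤ q * 2 ^ (2 * k) ∧
    6 * k * (m * (3 * k + 1)) ≤ d := by
  have ev : ∀ᶠ x : ℝ in Filter.atTop, 10 ≤ Real.log x ∧ 10 ^ 9 * Real.log x ^ 4 ≤ x := by
    refine (Real.tendsto_log_atTop.eventually_ge_atTop 10).and ?_
    have := (Real.isLittleO_pow_log_id_atTop (n := 4)).bound (c := 1 / 10 ^ 9) (by norm_num)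
    filter_upwards [this, Filter.eventually_ge_atTop 1] with x hx hx1
    have h0 : 0 ≤ Real.log x := Real.log_nonneg hx1
    simp only [id, Real.norm_eq_abs] at hx
    rw [abs_of_nonneg (by positivity), abs_of_nonneg (by linarith)] at hx
    linarith
  have ev2 := tendsto_natCast_atTop_atTop (R := ℝ) |>.eventually ev
  obtain ⟨d₀, hd₀⟩ := Filter.eventually_atTop.1 ev2
  refine ⟨d₀ + 1, fun d hd => ?_⟩
  obtain ⟨hL, hdL⟩ := hd₀ d (by omega)
  have hd1 : 1 ≤ d := by omega
  set L := Real.log d with hLdef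
  have hdpos : (0:ℝ) < d := by exact_mod_cast hd1
  have hLpos : 0 < L := by linarith
  set y := ((d : ℝ) / L) ^ ((1 : ℝ) / 3) with hy
  have hy0 : 0 ≤ y := by positivity
  have hy3 : y ^ 3 = d / L := by
    rw [hy, ← Real.rpow_natCast, ← Real.rpow_mul (by positivity)]
    norm_num
  have hy3' : y ^ 3 * L = d := by rw [hy3]; field_simp
  -- y ≥ 1000 L
  have hyL : 1000 * L ≤ y := by
    by_contra h
    push Not at h
    have h1 : y ^ 3 < (1000 * L) ^ 3 := pow_lt_pow_left₀ h hy0 (by norm_num)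
    have h2 : y ^ 3 * L < (1000 * L) ^ 3 * L := mul_lt_mul_of_pos_right h1 hLpos
    nlinarith
  have hkex : ∃ k : ℕ, 1 / 40 * y ≤ k ∧ (k:ℝ) ≤ y / 20 := by
    refine ⟨⌈1 / 40 * y⌉₊, Nat.le_ceil _, ?_⟩
    have := Nat.ceil_lt_add_one (a := 1 / 40 * y) (by positivity)
    linarith
  obtain ⟨k, hk1, hk2⟩ := hkex
  have hkL : 25 * L ≤ k := by linarith
  have hk0 : (250:ℝ) ≤ k := by linarith
  have hmex : ∃ m : ℕ, 300 * k * L ≤ m ∧ (m:ℝ) ≤ 301 * k * L := by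
    refine ⟨⌈300 * k * L⌉₊, Nat.le_ceil _, ?_⟩
    have := Nat.ceil_lt_add_one (a := 300 * k * L) (by positivity)
    nlinarith
  obtain ⟨m, hm1, hm2⟩ := hmex
  have hLL : L ≤ L ^ 4 := by
    have : 1 ≤ L ^ 3 := one_le_pow₀ (by linarith)
    nlinarith
  have hNex : ∃ N : ℕ, d / (32 * L) ≤ N ∧ (N:ℝ) ≤ d / (16 * L) := by
    refine ⟨⌊d / (16 * L)⌋₊, ?_, Nat.floor_le (by positivity)⟩
    have := Nat.lt_floor_add_one (d / (16 * L))
    have h1 : 1 ≤ d / (32 * L) := by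
      rw [le_div_iff₀ (by positivity)]; linarith
    have h2 : d / (16 * L) = 2 * (d / (32 * L)) := by field_simp; norm_num
    linarith
  obtain ⟨N, hN1, hN2⟩ := hNex
  have hN0 : (1000:ℝ) ≤ N := by
    refine le_trans ?_ hN1
    rw [le_div_iff₀ (by positivity)]; linarith
  have hNpos : (0:ℝ) < N := by linarith
  have hexpL : Real.exp L = d := Real.exp_log hdpos
  have hlog2 : (0.69:ℝ) < Real.log 2 := by have := Real.log_two_gt_d9; linarith
  have two_pow : ∀ n : ℕ, (2:ℝ) ^ n = Real.exp (n * Real.log 2) := by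
    intro n
    rw [Real.exp_nat_mul, Real.exp_log (by norm_num)]
  have hkd : (k:ℝ) ≤ d / 1000 := by
    have h1 : (1:ℝ) ≤ y := by linarith
    have : y * (y * y * L) = d := by rw [← hy3']; ring
    have h2 : 100 ≤ y * y * L := by nlinarith
    nlinarith
  refine ⟨k, m, N, Real.exp (-(8 * L)), hk1, hd1, ?_, ?_, ?_, Real.exp_pos _, ?_, ?_, ?_, ?_, ?_⟩
  · have : (1:ℝ) ≤ k := by linarith
    exact_mod_cast this
  · have : (1:ℝ) ≤ m := by nlinarith
    exact_mod_cast this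
  · have : (1:ℝ) ≤ N := by linarith
    exact_mod_cast this
  · have e : Real.exp (-(8 * L)) = ((d:ℝ) ^ 8)⁻¹ := by
      rw [Real.exp_neg, ← hexpL, ← Real.exp_nat_mul]; norm_num
    rw [e]
    have h1 : (5 * k * d : ℝ) ≤ d ^ 2 := by nlinarith
    have h2 : (5 * k * d : ℝ) ^ 2 ≤ (d ^ 2) ^ 2 := pow_le_pow_left₀ (by positivity) h1 2
    have h3 : (8:ℝ) ≤ d := by linarith
    have h4 : (1:ℝ) ≤ d := by linarith
    rw [mul_right_comm, ← div_eq_mul_inv, div_le_one (by positivity)]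
    calc 8 * (5 * k * d : ℝ) ^ 2 ≤ (d:ℝ) * ((d:ℝ) ^ 2) ^ 2 := by
          apply mul_le_mul h3 h2 (by positivity) (by positivity)
      _ = (d:ℝ) ^ 5 := by ring
      _ ≤ (d:ℝ) ^ 8 := pow_le_pow_right₀ h4 (by norm_num)
  · rw [Real.exp_le_exp, neg_le_neg_iff, le_div_iff₀ hNpos]
    rw [le_div_iff₀ (by positivity)] at hN2
    linarith
  · rw [two_pow, ← Real.exp_add, Real.exp_le_exp]
    have h1 : (5 * k * d : ℝ) / N ≤ 160 * k * L := by
      rw [div_le_iff₀ hNpos]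
      rw [div_le_iff₀ (by positivity)] at hN1
      nlinarith
    have h2 : (300 * k * L) * 0.69 ≤ m * Real.log 2 :=
      mul_le_mul hm1 hlog2.le (by norm_num) (by positivity)
    nlinarith
  · rw [two_pow, ← Real.exp_add, Real.exp_le_exp]
    have h1 : (5 * k : ℝ) / N ≤ k / 100 := by
      rw [div_le_iff₀ hNpos]
      nlinarith
    push_cast
    nlinarith
  · have : (6 * k * (m * (3 * k + 1)) : ℝ) ≤ d := by
      have h1 : (3 * k + 1 : ℝ) ≤ 4 * k := by linarith
      have h2 : (k:ℝ) ^ 3 ≤ (y / 20) ^ 3 := pow_le_pow_left₀ (by positivity) hk2 3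
      calc (6 * k * (m * (3 * k + 1)) : ℝ) ≤ 6 * k * ((301 * k * L) * (4 * k)) := by gcongr
        _ = 7224 * (k ^ 3 * L) := by ring
        _ ≤ 7224 * ((y / 20) ^ 3 * L) := by gcongr
        _ = 7224 / 8000 * (y ^ 3 * L) := by ring
        _ ≤ d := by rw [hy3']; linarith
    exact_mod_cast this

end sf

/-- There is an absolute constant `c > 0` such that for all sufficiently large `d`,
every finite simple graph with minimum degree at least `d` contains a star factor
in which every star has at least `c * (d / log d)^(1/3)` edges. -/
theorem star_factor_min_degree : ∃ c : ℝ, 0 < c ∧ ∃ d₀ : ℕ, ∀ d : ℕ, d₀ ≤ d →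
    ∀ (V : Type) [Fintype V] [DecidableEq V] (G : SimpleGraph V) [DecidableRel G.Adj],
      (∀ v : V, d ≤ G.degree v) →
      ∃ (C : Finset V) (f : V → V),
        (∀ v : V, v ∉ C → f v ∈ C ∧ G.Adj v (f v)) ∧
        (∀ c' ∈ C,
          c * ((d : ℝ) / Real.log d) ^ ((1 : ℝ) / 3)
            ≤ ((Finset.univ.filter (fun v => v ∉ C ∧ f v = c')).card : ℝ)) := by

  obtain ⟨d₀, h⟩ := sf_numeric
  refine ⟨1 / 40, by norm_num, d₀, ?_⟩
  intro d hd V _ _ G _ hG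
  obtain ⟨k, m, N, q, hk, a1, a2, a3, a4, a5, a6, a7, a8, a9, a10⟩ := h d hd
  obtain ⟨nb, b1, b2, b3, b4⟩ := sf_minimal G d hG
  obtain ⟨C, f, hf, hC⟩ := sf_core nb b2 (fun v hv => (b1 v v hv).ne rfl) d k m N q a1 a2 a3 a4
    b3 b4 a5 a6 a7 a8 a9 a10
  refine ⟨C, f, fun v hv => ⟨(hf v hv).1, b1 _ _ (hf v hv).2⟩, fun c hc => hk.trans ?_⟩
  exact_mod_cast hC c hc
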